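/- arXiv:math/0601774 — 2 statements merged into one kernel-verified Lean document; each statement's English description precedes it below -/
import Mathlib

section
/- Extended Pierce Lemma: For every r > 0 and δ > 0 there exists a finite constant C_{r,δ} > 0 such that for every real-valued random variable X on any probability space with E|X|^{r+δ} < ∞ and every integer N ≥ 1, inf{ (E[min_{a∈α}|X−a|^r])^{1/r} : α ⊆ ℝ finite, card(α) ≤ N } ≤ C_{r,δ} · (E|X|^{r+δ})^{1/(r+δ)} · N^{−1}. -/
open MeasureTheory ProbabilityTheory Filter Set
open scoped ENNReal NNReal

/-- The level-`N`, `L^r`-quantization error of a real random variable `X`. -/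
noncomputable def quantErr {Ω : Type*} [MeasurableSpace Ω] (P : Measure Ω)
    (X : Ω → ℝ) (r : ℝ) (N : ℕ) : ℝ :=
  sInf { e : ℝ | ∃ α : Finset ℝ, α.Nonempty ∧ α.card ≤ N ∧
    e = (∫ ω, (⨅ a : α, |X ω - (a : ℝ)|) ^ r ∂P) ^ (1 / r) }

/-- The level-`N`, `(L^r(P), L^p([0,T],dt))`-functional quantization error of a process `X`. -/
noncomputable def pathQuantErr {Ω : Type*} [MeasurableSpace Ω] (P : Measure Ω)
    (X : ℝ → Ω → ℝ) (T p r : ℝ) (N : ℕ) : ℝ :=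
  sInf { e : ℝ | ∃ α : Finset (ℝ → ℝ), α.Nonempty ∧ α.card ≤ N ∧
    e = (∫ ω, (⨅ f : α,
          (∫ t in Set.Icc (0 : ℝ) T, |X t ω - (f : ℝ → ℝ) t| ^ p) ^ (1 / p)) ^ r ∂P) ^ (1 / r) }

/-- `φ` is regularly varying at `0` with index `b`. -/
def RegVaryAt0 (φ : ℝ → ℝ) (b : ℝ) : Prop :=
  ∀ t : ℝ, 0 < t →
    Filter.Tendsto (fun x => φ (t * x) / φ x) (nhdsWithin 0 (Set.Ioi 0)) (nhds (t ^ b))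

/-- Tangent-line bound for the convex function `t ↦ t ^ (-c)`. -/
lemma rpow_neg_sub_rpow_neg_le {c u v : ℝ} (hc : 0 < c) (hu : 0 < u) (hv : 0 < v) :
    u ^ (-c) - v ^ (-c) ≤ c * u ^ (-c - 1) * (v - u) := by
  have hvu : v ^ (-c) = u ^ (-c) * (v / u) ^ (-c) := by
    rw [← Real.mul_rpow hu.le (by positivity), mul_div_cancel₀ _ hu.ne']
  have hone : 1 - c * (v / u - 1) ≤ (v / u) ^ (-c) := by
    rw [Real.rpow_def_of_pos (by positivity)]
    have hexp := Real.add_one_le_exp (Real.log (v / u) * -c)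
    have hlog := Real.log_le_sub_one_of_pos (x := v / u) (by positivity)
    nlinarith
  have hsub : u ^ (-c - 1) * (v - u) = u ^ (-c) * (v / u - 1) := by
    rw [Real.rpow_sub_one hu.ne']
    field_simp
  have hupos : 0 < u ^ (-c) := by positivity
  rw [hvu, mul_assoc, hsub]
  nlinarith

/-- The `k`-th nonnegative point of a grid of `n` points whose spacing near `x` is of order
`(1 + x) ^ (1 + s) / n`. -/
noncomputable def pierceNode (s : ℝ) (n k : ℕ) : ℝ :=
  (1 - (k : ℝ) / n) ^ (-s⁻¹) - 1

lemma pierceNode_zero (s : ℝ) (n : ℕ) : pierceNode s n 0 = 0 := by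
  simp [pierceNode]

/-- Every `x ≥ 0` is close to a grid point, with an error weighted by `(1 + x) ^ (1 + s)`. -/
lemma exists_abs_sub_pierceNode_le {s x : ℝ} (hs : 0 < s) (hx : 0 ≤ x) {n : ℕ} (hn : 0 < n) :
    ∃ k < n, |x - pierceNode s n k| ≤ s⁻¹ * (1 + x) ^ (1 + s) / n := by
  have hn' : (0 : ℝ) < n := by exact_mod_cast hn
  have hx1 : 0 < 1 + x := by linarith
  set u : ℝ := (1 + x) ^ (-s) with hu
  have hupos : 0 < u := by positivity
  have hule : u ≤ 1 := Real.rpow_le_one_of_one_le_of_nonpos (by linarith) (by linarith)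
  have hnonneg : 0 ≤ n * (1 - u) := mul_nonneg hn'.le (by linarith)
  have hfloor_le := Nat.floor_le hnonneg
  have hlt_floor := Nat.lt_floor_add_one (n * (1 - u))
  set k := ⌊n * (1 - u)⌋₊
  have hle : (k : ℝ) / n ≤ 1 - u := by
    rw [div_le_iff₀ hn']
    linarith
  have hgt : 1 - u - 1 / n ≤ (k : ℝ) / n := by
    rw [le_div_iff₀ hn', sub_mul, one_div_mul_cancel hn'.ne']
    linarith
  have hkn : (k : ℝ) < n := by nlinarith
  have hxu : u ^ (-s⁻¹) = 1 + x := by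
    rw [hu, ← Real.rpow_mul hx1.le, neg_mul_neg, mul_inv_cancel₀ hs.ne', Real.rpow_one]
  have hxu' : u ^ (-s⁻¹ - 1) = (1 + x) ^ (1 + s) := by
    rw [hu, ← Real.rpow_mul hx1.le]
    congr 1
    field_simp
    ring
  refine ⟨k, by exact_mod_cast hkn, ?_⟩
  have hv : u ≤ 1 - (k : ℝ) / n := by linarith
  have htangent := rpow_neg_sub_rpow_neg_le (inv_pos.2 hs) hupos (hupos.trans_le hv)
  have hmono : (1 - (k : ℝ) / n) ^ (-s⁻¹) ≤ u ^ (-s⁻¹) :=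
    Real.rpow_le_rpow_of_nonpos hupos hv (by simpa using hs.le)
  rw [hxu, hxu'] at htangent
  rw [hxu] at hmono
  have hpos : 0 ≤ s⁻¹ * (1 + x) ^ (1 + s) := by positivity
  rw [pierceNode, abs_of_nonneg (by linarith)]
  calc x - ((1 - (k : ℝ) / n) ^ (-s⁻¹) - 1)
      = 1 + x - (1 - (k : ℝ) / n) ^ (-s⁻¹) := by ring
    _ ≤ _ := htangent
    _ ≤ s⁻¹ * (1 + x) ^ (1 + s) * (1 / n) := mul_le_mul_of_nonneg_left (by linarith) hpos
    _ = _ := mul_one_div _ _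

/-- A universal grid of at most `N` points whose distance to any `x` is of order
`(1 + |x|) ^ (1 + s) / N`. -/
lemma exists_finset_abs_sub_le {s : ℝ} (hs : 0 < s) {N : ℕ} (hN : 1 ≤ N) :
    ∃ α : Finset ℝ, α.Nonempty ∧ α.card ≤ N ∧
      ∀ x : ℝ, ∃ a ∈ α, |x - a| ≤ 2 * s⁻¹ * (1 + |x|) ^ (1 + s) / N := by
  obtain ⟨n, hn, hnN, hNn⟩ : ∃ n : ℕ, 0 < n ∧ n + (n - 1) ≤ N ∧ N ≤ 2 * n :=
    ⟨(N + 1) / 2, by omega, by omega, by omega⟩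
  have hN' : (0 : ℝ) < N := by exact_mod_cast hN
  have hn' : (0 : ℝ) < n := by exact_mod_cast hn
  have hNn' : (N : ℝ) ≤ 2 * n := by exact_mod_cast hNn
  have hscale (x : ℝ) : s⁻¹ * (1 + |x|) ^ (1 + s) / n
      ≤ 2 * s⁻¹ * (1 + |x|) ^ (1 + s) / N := by
    rw [div_le_div_iff₀ hn' hN']
    have hpos : 0 ≤ s⁻¹ * (1 + |x|) ^ (1 + s) := by positivity
    nlinarith
  refine ⟨(Finset.range n).image (pierceNode s n) ∪
      (Finset.Ico 1 n).image (fun k => -pierceNode s n k), ?_, ?_, fun x => ?_⟩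
  · exact ⟨pierceNode s n 0, Finset.mem_union_left _
      (Finset.mem_image_of_mem _ (Finset.mem_range.2 hn))⟩
  · calc _ ≤ _ := Finset.card_union_le _ _
      _ ≤ (Finset.range n).card + (Finset.Ico 1 n).card :=
        add_le_add Finset.card_image_le Finset.card_image_le
      _ ≤ N := by simpa using hnN
  · obtain ⟨k, hk, hxk⟩ := exists_abs_sub_pierceNode_le hs (abs_nonneg x) hn
    replace hxk := hxk.trans (hscale x)
    rcases le_total 0 x with hx | hx
    · refine ⟨pierceNode s n k, Finset.mem_union_left _
        (Finset.mem_image_of_mem _ (Finset.mem_range.2 hk)), ?_⟩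
      rwa [abs_of_nonneg hx] at hxk ⊢
    · have hxk' : |x - -pierceNode s n k| ≤ 2 * s⁻¹ * (1 + |x|) ^ (1 + s) / N := by
        rw [← abs_neg, show -(x - -pierceNode s n k) = |x| - pierceNode s n k by
          rw [abs_of_nonpos hx]; ring]
        exact hxk
      rcases Nat.eq_zero_or_pos k with rfl | hkpos
      · refine ⟨pierceNode s n 0, Finset.mem_union_left _
          (Finset.mem_image_of_mem _ (Finset.mem_range.2 hk)), ?_⟩
        simpa [pierceNode_zero] using hxk'
      · exact ⟨-pierceNode s n k, Finset.mem_union_right _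
          (Finset.mem_image_of_mem _ (Finset.mem_Ico.2 ⟨hkpos, hk⟩)), hxk'⟩

lemma one_add_rpow_le {y p : ℝ} (hy : 0 ≤ y) (hp : 0 ≤ p) :
    (1 + y) ^ p ≤ 2 ^ p * (1 + y ^ p) := by
  have hyp : 0 ≤ y ^ p := by positivity
  rcases le_total y 1 with h | h
  · calc (1 + y) ^ p ≤ 2 ^ p := Real.rpow_le_rpow (by positivity) (by linarith) hp
      _ ≤ 2 ^ p * (1 + y ^ p) := le_mul_of_one_le_right (by positivity) (by linarith)
  · calc (1 + y) ^ p ≤ (2 * y) ^ p := Real.rpow_le_rpow (by positivity) (by linarith) hp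
      _ = 2 ^ p * y ^ p := Real.mul_rpow (by norm_num) hy
      _ ≤ 2 ^ p * (1 + y ^ p) := by gcongr; linarith

lemma quantErr_le_of_finset {Ω : Type*} [MeasurableSpace Ω] (P : Measure Ω) (X : Ω → ℝ) (r : ℝ)
    {N : ℕ} {α : Finset ℝ} (hα : α.Nonempty) (hcard : α.card ≤ N) :
    quantErr P X r N ≤ (∫ ω, (⨅ a : α, |X ω - (a : ℝ)|) ^ r ∂P) ^ (1 / r) := by
  refine csInf_le ⟨0, ?_⟩ ⟨α, hα, hcard, rfl⟩
  rintro _ ⟨β, -, -, rfl⟩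
  exact Real.rpow_nonneg (integral_nonneg fun ω =>
    Real.rpow_nonneg (Real.iInf_nonneg fun _ => abs_nonneg _) _) _

/-- Pierce's bound in terms of any scale `m` dominating the `L^(r + δ)`-norm of `X`. -/
lemma quantErr_le_of_integral_le {Ω : Type*} [MeasurableSpace Ω] (P : Measure Ω)
    [IsProbabilityMeasure P] {X : Ω → ℝ} {r δ m : ℝ} (hr : 0 < r) (hδ : 0 < δ) (hm : 0 < m)
    (hX : Integrable (fun ω => |X ω| ^ (r + δ)) P)
    (hXm : ∫ ω, |X ω| ^ (r + δ) ∂P ≤ m ^ (r + δ)) {N : ℕ} (hN : 1 ≤ N) :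
    quantErr P X r N
      ≤ 2 * (δ / r)⁻¹ * (2 ^ (r + δ) * 2) ^ (1 / r) * m * (N : ℝ)⁻¹ := by
  have hN' : (0 : ℝ) < N := by exact_mod_cast hN
  have hs : 0 < δ / r := by positivity
  obtain ⟨α, hα, hcard, hαx⟩ := exists_finset_abs_sub_le hs hN
  set K : ℝ := m * (2 * (δ / r)⁻¹) / N with hK
  have hKpos : 0 < K := by positivity
  have hpoint (ω : Ω) : (⨅ a : α.image (m * ·), |X ω - (a : ℝ)|) ^ r
      ≤ K ^ r * (2 ^ (r + δ) * (1 + |X ω| ^ (r + δ) / m ^ (r + δ))) := by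
    obtain ⟨a, ha, hle⟩ := hαx (X ω / m)
    have hdist : ⨅ a : α.image (m * ·), |X ω - (a : ℝ)|
        ≤ K * (1 + |X ω| / m) ^ (1 + δ / r) := by
      refine (ciInf_le (f := fun a : α.image (m * ·) => |X ω - (a : ℝ)|)
        ⟨0, by rintro _ ⟨b, rfl⟩; exact abs_nonneg _⟩
        ⟨m * a, Finset.mem_image_of_mem _ ha⟩).trans ?_
      calc |X ω - m * a| = m * |X ω / m - a| := by
            rw [← abs_of_pos hm, ← abs_mul, abs_of_pos hm, mul_sub, mul_div_cancel₀ _ hm.ne']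
        _ ≤ m * (2 * (δ / r)⁻¹ * (1 + |X ω / m|) ^ (1 + δ / r) / N) := by gcongr
        _ = K * (1 + |X ω| / m) ^ (1 + δ / r) := by
            rw [abs_div, abs_of_pos hm, hK]; ring
    calc _ ≤ (K * (1 + |X ω| / m) ^ (1 + δ / r)) ^ r :=
          Real.rpow_le_rpow (Real.iInf_nonneg fun _ => abs_nonneg _) hdist hr.le
      _ = K ^ r * (1 + |X ω| / m) ^ (r + δ) := by
          rw [Real.mul_rpow hKpos.le (by positivity), ← Real.rpow_mul (by positivity)]
          congr 2
          field_simp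
      _ ≤ _ := by
          rw [← Real.div_rpow (abs_nonneg _) hm.le]
          gcongr
          exact one_add_rpow_le (by positivity) (by positivity)
  have hint : ∫ ω, (⨅ a : α.image (m * ·), |X ω - (a : ℝ)|) ^ r ∂P
      ≤ K ^ r * (2 ^ (r + δ) * 2) := by
    calc _ ≤ ∫ ω, K ^ r * (2 ^ (r + δ) * (1 + |X ω| ^ (r + δ) / m ^ (r + δ))) ∂P :=
          integral_mono_of_nonneg
            (ae_of_all _ fun ω => Real.rpow_nonneg (Real.iInf_nonneg fun _ => abs_nonneg _) _)
            ((((integrable_const 1).add (hX.div_const _)).const_mul _).const_mul _)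
            (ae_of_all _ hpoint)
      _ = K ^ r * (2 ^ (r + δ) * (1 + (∫ ω, |X ω| ^ (r + δ) ∂P) / m ^ (r + δ))) := by
          rw [integral_const_mul, integral_const_mul,
            integral_add (integrable_const 1) (hX.div_const _), integral_div]
          simp
      _ ≤ K ^ r * (2 ^ (r + δ) * 2) := by
          have hdiv : (∫ ω, |X ω| ^ (r + δ) ∂P) / m ^ (r + δ) ≤ 1 :=
            div_le_one_of_le₀ hXm (by positivity)
          gcongr
          linarith
  calc quantErr P X r N
      ≤ _ := quantErr_le_of_finset P X r (hα.image _) (Finset.card_image_le.trans hcard)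
    _ ≤ (K ^ r * (2 ^ (r + δ) * 2)) ^ (1 / r) :=
        Real.rpow_le_rpow (integral_nonneg fun ω =>
          Real.rpow_nonneg (Real.iInf_nonneg fun _ => abs_nonneg _) _) hint (by positivity)
    _ = K * (2 ^ (r + δ) * 2) ^ (1 / r) := by
        rw [Real.mul_rpow (by positivity) (by positivity), ← Real.rpow_mul hKpos.le,
          mul_one_div_cancel hr.ne', Real.rpow_one]
    _ = _ := by rw [hK]; ring

/-- **Extended Pierce lemma.** For every `r, δ > 0` there is a constant `C` such that for
every real random variable `X` with `E|X|^{r+δ} < ∞` and every `N ≥ 1`,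
`e_{N,r}(X, ℝ) ≤ C ‖X‖_{r+δ} N⁻¹`. -/
theorem extended_pierce_lemma (r δ : ℝ) (hr : 0 < r) (hδ : 0 < δ) :
    ∃ C : ℝ, 0 < C ∧
      ∀ (Ω : Type) (_ : MeasurableSpace Ω) (P : Measure Ω), IsProbabilityMeasure P →
        ∀ X : Ω → ℝ, Measurable X →
          Integrable (fun ω => |X ω| ^ (r + δ)) P →
          ∀ N : ℕ, 1 ≤ N →
            quantErr P X r N
              ≤ C * (∫ ω, |X ω| ^ (r + δ) ∂P) ^ (1 / (r + δ)) * (N : ℝ)⁻¹ := by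
  set C : ℝ := 2 * (δ / r)⁻¹ * (2 ^ (r + δ) * 2) ^ (1 / r) with hC
  have hCpos : 0 < C := by positivity
  refine ⟨C, hCpos, fun Ω _ P _ X _ hX N hN => ?_⟩
  have hN' : (0 : ℝ) < N := by exact_mod_cast hN
  set I := ∫ ω, |X ω| ^ (r + δ) ∂P
  have hI : 0 ≤ I := integral_nonneg fun ω => by positivity
  have hbound (m : ℝ) (hm : I ^ (1 / (r + δ)) < m) :
      quantErr P X r N * N / C ≤ m := by
    have hroot : 0 ≤ I ^ (1 / (r + δ)) := by positivity
    have hIm : I ≤ m ^ (r + δ) := by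
      have hpow := Real.rpow_le_rpow hroot hm.le (by positivity : 0 ≤ r + δ)
      rwa [← Real.rpow_mul hI, one_div_mul_cancel (by positivity), Real.rpow_one] at hpow
    have hq := quantErr_le_of_integral_le P hr hδ (hroot.trans_lt hm) hX hIm hN
    rwa [← hC, ← div_eq_mul_inv, le_div_iff₀ hN', ← div_le_iff₀' hCpos] at hq
  have hlimit := le_of_forall_gt_imp_ge_of_dense hbound
  rwa [← div_eq_mul_inv, le_div_iff₀ hN', ← div_le_iff₀' hCpos]
end

section
/- Let ν be the Lévy measure of a Lévy process with Blumenthal–Getoor index θ > 0, and let ν̄(u) := ν({x : |x| > u}) be its tail function on (0,∞). If ν̄ is regularly varying at 0 with index −b (i.e. for every t > 0, ν̄(tx)/ν̄(x) → t^{−b} as x → 0+), then b = θ, and the function ℓ̄(t) := t · ν̄(t^{1/θ}) is slowly varying at 0 (for every s > 0, ℓ̄(st)/ℓ̄(t) → 1 as t → 0+). -/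
open MeasureTheory Filter Set
open scoped ENNReal NNReal

/-- The Blumenthal–Getoor index of a Lévy measure `ν`. -/
noncomputable def bgIndex (ν : Measure ℝ) : ℝ :=
  sInf {t : ℝ | 0 < t ∧ ∫⁻ x in {x : ℝ | |x| ≤ 1}, ENNReal.ofReal (|x| ^ t) ∂ν < ⊤}

/-- The tail of a Lévy measure is finite away from the origin. -/
lemma levy_tail_lt_top {ν : Measure ℝ}
    (hνint : ∫⁻ x : ℝ, ENNReal.ofReal (min (x ^ 2) 1) ∂ν < ⊤) {u : ℝ} (hu : 0 < u) :
    ν {y : ℝ | u < |y|} < ⊤ := by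
  have hc : 0 < min (u ^ 2) 1 := lt_min (by positivity) one_pos
  have hsub : {y : ℝ | u < |y|} ⊆
      {y : ℝ | ENNReal.ofReal (min (u ^ 2) 1) ≤ ENNReal.ofReal (min (y ^ 2) 1)} := by
    intro y hy
    have hy' : u < |y| := hy
    refine ENNReal.ofReal_le_ofReal (min_le_min_right 1 ?_)
    rw [← sq_abs y]
    gcongr
  refine (measure_mono hsub).trans_lt ?_
  have hc' : ENNReal.ofReal (min (u ^ 2) 1) ≠ 0 := (ENNReal.ofReal_pos.2 hc).ne'
  exact (meas_ge_le_lintegral_div (by fun_prop) hc' ENNReal.ofReal_ne_top).trans_lt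
    (ENNReal.div_lt_top hνint.ne hc')

/-- The dyadic weighted tail `2^{-nt} ν̄(2^{-n})`. -/
noncomputable def dyadicTail (ν : Measure ℝ) (t : ℝ) (n : ℕ) : ℝ :=
  (((1 / 2 : ℝ) ^ n) ^ t) * (ν {y : ℝ | (1 / 2 : ℝ) ^ n < |y|}).toReal

lemma dyadicTail_nonneg (ν : Measure ℝ) (t : ℝ) (n : ℕ) : 0 ≤ dyadicTail ν t n := by
  unfold dyadicTail; positivity

/-- If the dyadic weighted tails are summable, the truncated `t`-th moment is finite. -/
lemma lintegral_rpow_lt_top_of_summable {ν : Measure ℝ}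
    (hfin : ∀ u : ℝ, 0 < u → ν {y : ℝ | u < |y|} < ⊤) {t : ℝ} (ht : 0 < t)
    (hs : Summable (dyadicTail ν t)) :
    ∫⁻ x in {x : ℝ | |x| ≤ 1}, ENNReal.ofReal (|x| ^ t) ∂ν < ⊤ := by
  have hmeas : ∀ n : ℕ, MeasurableSet {y : ℝ | (1 / 2 : ℝ) ^ (n + 1) < |y|} := fun n =>
    measurableSet_lt measurable_const measurable_id.abs
  have hpt : ∀ x ∈ {x : ℝ | |x| ≤ 1}, ENNReal.ofReal (|x| ^ t) ≤
      ∑' n : ℕ, {y : ℝ | (1 / 2 : ℝ) ^ (n + 1) < |y|}.indicator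
        (fun _ => ENNReal.ofReal (((1 / 2 : ℝ) ^ n) ^ t)) x := by
    intro x hx
    rcases eq_or_ne x 0 with rfl | hx0
    · simp [Real.zero_rpow ht.ne']
    obtain ⟨n, hn, hn'⟩ := exists_nat_pow_near_of_lt_one (abs_pos.2 hx0) hx
      (by norm_num : (0 : ℝ) < 1 / 2) (by norm_num)
    refine le_trans ?_ (ENNReal.le_tsum n)
    rw [indicator_of_mem (by exact hn)]
    exact ENNReal.ofReal_le_ofReal (Real.rpow_le_rpow (abs_nonneg x) hn' ht.le)
  calc ∫⁻ x in {x : ℝ | |x| ≤ 1}, ENNReal.ofReal (|x| ^ t) ∂ν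
      ≤ ∫⁻ x in {x : ℝ | |x| ≤ 1}, ∑' n : ℕ, {y : ℝ | (1 / 2 : ℝ) ^ (n + 1) < |y|}.indicator
        (fun _ => ENNReal.ofReal (((1 / 2 : ℝ) ^ n) ^ t)) x ∂ν :=
        setLIntegral_mono' (measurableSet_le measurable_id.abs measurable_const) hpt
    _ ≤ ∫⁻ x, ∑' n : ℕ, {y : ℝ | (1 / 2 : ℝ) ^ (n + 1) < |y|}.indicator
        (fun _ => ENNReal.ofReal (((1 / 2 : ℝ) ^ n) ^ t)) x ∂ν := setLIntegral_le_lintegral _ _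
    _ = ∑' n : ℕ, ENNReal.ofReal (2 ^ t * dyadicTail ν t (n + 1)) := by
        rw [lintegral_tsum fun n => (measurable_const.indicator (hmeas n)).aemeasurable]
        refine tsum_congr fun n => ?_
        rw [lintegral_indicator_const (hmeas n), dyadicTail, ← mul_assoc,
          ← Real.mul_rpow (by norm_num) (by positivity), ENNReal.ofReal_mul (by positivity),
          ENNReal.ofReal_toReal (hfin _ (by positivity)).ne]
        congr 3
        ring
    _ < ⊤ := (((summable_nat_add_iff 1).2 hs).mul_left (2 ^ t)).tsum_ofReal_lt_top

/-- If the truncated `t`-th moment is finite, the dyadic weighted tails of any larger exponent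
are summable. -/
lemma summable_dyadicTail_of_lintegral {ν : Measure ℝ}
    (hfin : ∀ u : ℝ, 0 < u → ν {y : ℝ | u < |y|} < ⊤) {t t' : ℝ} (ht : 0 < t) (htt' : t < t')
    (hint : ∫⁻ x in {x : ℝ | |x| ≤ 1}, ENNReal.ofReal (|x| ^ t) ∂ν < ⊤) :
    Summable (dyadicTail ν t') := by
  set I := ∫⁻ x in {x : ℝ | |x| ≤ 1}, ENNReal.ofReal (|x| ^ t) ∂ν
  set C := I + ν {y : ℝ | 1 < |y|}
  have hCtop : C < ⊤ := ENNReal.add_lt_top.2 ⟨hint, hfin 1 one_pos⟩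
  have hbound : ∀ n : ℕ, dyadicTail ν t n ≤ C.toReal := by
    intro n
    have hu : (0 : ℝ) < (1 / 2) ^ n := by positivity
    have hu1 : (1 / 2 : ℝ) ^ n ≤ 1 := pow_le_one₀ (by norm_num) (by norm_num)
    set u := (1 / 2 : ℝ) ^ n
    have hut : u ^ t ≤ 1 := Real.rpow_le_one hu.le hu1 ht.le
    have hm : MeasurableSet {y : ℝ | u < |y| ∧ |y| ≤ 1} :=
      (measurableSet_lt measurable_const measurable_id.abs).inter
        (measurableSet_le measurable_id.abs measurable_const)
    have hinner : ENNReal.ofReal (u ^ t) * ν {y : ℝ | u < |y| ∧ |y| ≤ 1} ≤ I := by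
      rw [← setLIntegral_const]
      refine (setLIntegral_mono' hm fun x hx => ENNReal.ofReal_le_ofReal
        (Real.rpow_le_rpow hu.le hx.1.le ht.le)).trans ?_
      exact lintegral_mono_set fun x hx => hx.2
    have hsub : {y : ℝ | u < |y|} ⊆ {y : ℝ | u < |y| ∧ |y| ≤ 1} ∪ {y : ℝ | 1 < |y|} := by
      intro y hy
      rcases le_or_gt |y| 1 with h | h
      · exact Or.inl ⟨hy, h⟩
      · exact Or.inr h
    have key : ENNReal.ofReal (u ^ t) * ν {y : ℝ | u < |y|} ≤ C := by
      refine (mul_le_mul_right ((measure_mono hsub).trans (measure_union_le _ _)) _).trans ?_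
      rw [mul_add]
      refine add_le_add hinner (mul_le_of_le_one_left' ?_)
      simpa using hut
    have := ENNReal.toReal_mono hCtop.ne key
    rwa [ENNReal.toReal_mul, ENNReal.toReal_ofReal (by positivity)] at this
  have hq : (1 / 2 : ℝ) ^ (t' - t) < 1 :=
    Real.rpow_lt_one (by norm_num) (by norm_num) (by linarith)
  refine Summable.of_nonneg_of_le (dyadicTail_nonneg ν t') (fun n => ?_)
    ((summable_geometric_of_lt_one (by positivity) hq).mul_right C.toReal)
  have hsplit : dyadicTail ν t' n = ((1 / 2 : ℝ) ^ (t' - t)) ^ n * dyadicTail ν t n := by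
    have hpow : ((1 / 2 : ℝ) ^ (t' - t)) ^ n = ((1 / 2 : ℝ) ^ n) ^ (t' - t) := by
      rw [← Real.rpow_mul_natCast (by norm_num), mul_comm, Real.rpow_natCast_mul (by norm_num)]
    rw [dyadicTail, dyadicTail, hpow, ← mul_assoc, ← Real.rpow_add (by positivity)]
    congr 2
    ring
  rw [hsplit]
  exact mul_le_mul_of_nonneg_left (hbound n) (by positivity)

/-- Successive ratios of dyadic weighted tails, for a tail which is regularly varying at `0`. -/
lemma tendsto_dyadicTail_ratio {ν : Measure ℝ} {b : ℝ}
    (hrv : Tendsto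
      (fun x : ℝ => (ν {y : ℝ | 1 / 2 * x < |y|}).toReal / (ν {y : ℝ | x < |y|}).toReal)
      (nhdsWithin 0 (Ioi 0)) (nhds ((1 / 2 : ℝ) ^ (-b)))) (t : ℝ) :
    Tendsto (fun n => ‖dyadicTail ν t (n + 1)‖ / ‖dyadicTail ν t n‖) atTop
      (nhds ((1 / 2 : ℝ) ^ (t - b))) := by
  have hseq : Tendsto (fun n : ℕ => (1 / 2 : ℝ) ^ n) atTop (nhdsWithin 0 (Ioi 0)) :=
    tendsto_nhdsWithin_iff.2 ⟨tendsto_pow_atTop_nhds_zero_of_lt_one (by norm_num) (by norm_num),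
      Eventually.of_forall fun n => by simp⟩
  have h := (hrv.comp hseq).const_mul ((1 / 2 : ℝ) ^ t)
  rw [← Real.rpow_add (by norm_num), ← sub_eq_add_neg] at h
  refine h.congr fun n => ?_
  rw [Real.norm_of_nonneg (dyadicTail_nonneg ν t _), Real.norm_of_nonneg (dyadicTail_nonneg ν t _),
    dyadicTail, dyadicTail, pow_succ', Real.mul_rpow (by norm_num) (by positivity)]
  have hpos : (0 : ℝ) < ((1 / 2 : ℝ) ^ n) ^ t := by positivity
  simp only [Function.comp]
  rw [mul_right_comm, mul_comm _ (((1 / 2 : ℝ) ^ n) ^ t), mul_div_mul_left _ _ hpos.ne',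
    mul_div_assoc]

/-- The index of regular variation of the tail is the Blumenthal–Getoor index, if positive. -/
lemma eq_bgIndex_of_tail_regularlyVarying {ν : Measure ℝ}
    (hfin : ∀ u : ℝ, 0 < u → ν {y : ℝ | u < |y|} < ⊤) (hθpos : 0 < bgIndex ν) {b : ℝ}
    (hrv : Tendsto
      (fun x : ℝ => (ν {y : ℝ | 1 / 2 * x < |y|}).toReal / (ν {y : ℝ | x < |y|}).toReal)
      (nhdsWithin 0 (Ioi 0)) (nhds ((1 / 2 : ℝ) ^ (-b)))) :
    b = bgIndex ν := by
  set S := {t : ℝ | 0 < t ∧ ∫⁻ x in {x : ℝ | |x| ≤ 1}, ENNReal.ofReal (|x| ^ t) ∂ν < ⊤}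
  have hbdd : BddBelow S := ⟨0, fun t ht => ht.1.le⟩
  have hratio := tendsto_dyadicTail_ratio hrv
  have hmem : ∀ t, max b 0 < t → t ∈ S := by
    intro t ht
    obtain ⟨hbt, ht0⟩ := max_lt_iff.1 ht
    have hlt : (1 / 2 : ℝ) ^ (t - b) < 1 :=
      Real.rpow_lt_one (by norm_num) (by norm_num) (by linarith)
    have hne : ∀ᶠ n in atTop, dyadicTail ν t n ≠ 0 := by
      have hpos : (0 : ℝ) < (1 / 2 : ℝ) ^ (t - b) := by positivity
      filter_upwards [(hratio t).eventually (lt_mem_nhds hpos)] with n hn h0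
      simp [h0] at hn
    exact ⟨ht0, lintegral_rpow_lt_top_of_summable hfin ht0
      (summable_of_ratio_test_tendsto_lt_one hlt hne (hratio t))⟩
  have hle : bgIndex ν ≤ max b 0 :=
    le_of_forall_gt_imp_ge_of_dense fun t ht => csInf_le hbdd (hmem t ht)
  have hleb : bgIndex ν ≤ b := (le_max_iff.1 hle).resolve_right hθpos.not_ge
  refine le_antisymm (le_csInf ⟨max b 0 + 1, hmem _ (lt_add_one _)⟩ fun t ht => ?_) hleb
  by_contra! htb
  obtain ⟨t', htt', ht'b⟩ := exists_between htb
  have hgt : 1 < (1 / 2 : ℝ) ^ (t' - b) :=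
    Real.one_lt_rpow_of_pos_of_lt_one_of_neg (by norm_num) (by norm_num) (by linarith)
  exact not_summable_of_ratio_test_tendsto_gt_one hgt (hratio t')
    (summable_dyadicTail_of_lintegral hfin ht.1 htt' ht.2)

/-- If the tail function `ν̄(u) = ν({|x| > u})` of a Lévy measure `ν` with
Blumenthal–Getoor index `θ > 0` is regularly varying at `0` with index `-b`, then `b = θ`
and `ℓ̄(t) = t·ν̄(t^{1/θ})` is slowly varying at `0`. -/
theorem tail_reg_varying_index_eq_bg
    (ν : Measure ℝ) (hν0 : ν {0} = 0)
    (hνint : ∫⁻ x : ℝ, ENNReal.ofReal (min (x ^ 2) 1) ∂ν < ⊤)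
    (hθpos : 0 < bgIndex ν) (b : ℝ)
    (hrv : ∀ t : ℝ, 0 < t →
      Filter.Tendsto
        (fun x : ℝ => (ν {y : ℝ | t * x < |y|}).toReal / (ν {y : ℝ | x < |y|}).toReal)
        (nhdsWithin 0 (Set.Ioi 0)) (nhds (t ^ (-b)))) :
    b = bgIndex ν ∧
    ∀ s : ℝ, 0 < s →
      Filter.Tendsto
        (fun t : ℝ =>
          (s * t * (ν {y : ℝ | (s * t) ^ (1 / bgIndex ν) < |y|}).toReal)
            / (t * (ν {y : ℝ | t ^ (1 / bgIndex ν) < |y|}).toReal))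
        (nhdsWithin 0 (Set.Ioi 0)) (nhds 1) := by
  have hb : b = bgIndex ν := eq_bgIndex_of_tail_regularlyVarying
    (fun u hu => levy_tail_lt_top hνint hu) hθpos (hrv (1 / 2) (by norm_num))
  refine ⟨hb, fun s hs => ?_⟩
  rw [← hb] at hθpos ⊢
  have hpow : Tendsto (fun t : ℝ => t ^ (1 / b)) (nhdsWithin 0 (Ioi 0))
      (nhdsWithin 0 (Ioi 0)) := by
    refine tendsto_nhdsWithin_iff.2 ⟨?_, ?_⟩
    · have hcont := (Real.continuousAt_rpow_const 0 (1 / b) (Or.inr (by positivity))).tendsto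
      rw [Real.zero_rpow (by positivity)] at hcont
      exact hcont.mono_left nhdsWithin_le_nhds
    · filter_upwards [self_mem_nhdsWithin] with t ht
      exact Real.rpow_pos_of_pos ht _
  have h := ((hrv (s ^ (1 / b)) (by positivity)).comp hpow).const_mul s
  have hlim : s * (s ^ (1 / b)) ^ (-b) = 1 := by
    rw [← Real.rpow_mul hs.le, show 1 / b * -b = -1 by field_simp, Real.rpow_neg_one,
      mul_inv_cancel₀ hs.ne']
  rw [hlim] at h
  refine h.congr' ?_
  filter_upwards [self_mem_nhdsWithin] with t ht
  have ht0 : (0 : ℝ) < t := ht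
  simp only [Function.comp]
  rw [Real.mul_rpow hs.le ht0.le, mul_comm s t, mul_assoc t s, mul_div_mul_left _ _ ht0.ne',
    mul_div_assoc]
end
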